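/- R is neither left noetherian nor right noetherian: there exists a strictly ascending infinite chain of left ideals of R, and a strictly ascending infinite chain of right ideals of R. -/

import Mathlib

/-!
`R = k⟨x,y⟩/⟨yx − 1⟩` is the associative `k`-algebra generated by `x` and `y`
with the single defining relation `y * x = 1` (the one-sided inverse of `k[x]`).
We realize it as the `RingQuot` of the free algebra on two generators.
-/

noncomputable section

/-- The defining relation `y * x = 1` on the free algebra `k⟨x,y⟩`. -/
inductive PreRel (k : Type) [Field k] : FreeAlgebra k (Fin 2) → FreeAlgebra k (Fin 2) → Prop
  | yx : PreRel k (FreeAlgebra.ι k 1 * FreeAlgebra.ι k 0) 1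

/-- `R = k⟨x,y⟩/⟨yx − 1⟩`. -/
abbrev R (k : Type) [Field k] := RingQuot (PreRel k)

/-- The generator `x` of `R`. -/
def Xg (k : Type) [Field k] : R k := RingQuot.mkAlgHom k (PreRel k) (FreeAlgebra.ι k 0)

/-- The generator `y` of `R`. -/
def Yg (k : Type) [Field k] : R k := RingQuot.mkAlgHom k (PreRel k) (FreeAlgebra.ι k 1)

theorem Yg_mul_Xg (k : Type) [Field k] : Yg k * Xg k = 1 := by
  unfold Yg Xg
  rw [← map_mul, RingQuot.mkAlgHom_rel k (PreRel.yx (k := k)), map_one]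

/-- The right shift on sequences. -/
def shiftX (k : Type) [Field k] : Module.End k (ℕ → k) where
  toFun f n := Nat.casesOn n 0 f
  map_add' f g := by ext n; cases n <;> simp
  map_smul' c f := by ext n; cases n <;> simp

/-- The left shift on sequences. -/
def shiftY (k : Type) [Field k] : Module.End k (ℕ → k) where
  toFun f n := f (n + 1)
  map_add' f g := rfl
  map_smul' c f := rfl

theorem shiftY_mul_shiftX (k : Type) [Field k] : shiftY k * shiftX k = 1 := by
  apply LinearMap.ext
  intro f
  rfl

/-- The action of `R` on sequences. -/
def repR (k : Type) [Field k] : R k →ₐ[k] Module.End k (ℕ → k) :=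
  RingQuot.liftAlgHom k ⟨FreeAlgebra.lift k ![shiftX k, shiftY k], by
    rintro _ _ ⟨⟩
    simpa using shiftY_mul_shiftX k⟩

theorem Xg_mul_Yg_ne (k : Type) [Field k] : Xg k * Yg k ≠ 1 := by
  intro h
  have h2 := congrArg (repR k) h
  simp only [map_mul, map_one, repR, Xg, Yg, RingQuot.liftAlgHom_mkAlgHom_apply,
    FreeAlgebra.lift_ι_apply] at h2
  have h3 := congrFun (LinearMap.congr_fun h2 (fun _ => 1)) 0
  have h4 : (0 : k) = 1 := h3
  exact zero_ne_one h4

theorem pow_mul_pow_one {A : Type} [Ring A] {x y : A} (h : y * x = 1) (n : ℕ) :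
    y ^ n * x ^ n = 1 := by
  induction n with
  | zero => simp
  | succ n ih =>
    rw [pow_succ, pow_succ', mul_assoc, ← mul_assoc y, h, one_mul, ih]

theorem key_mul {A : Type} [Ring A] {x y : A} (h : y * x = 1) (n : ℕ) :
    y ^ n * (1 - x ^ (n + 1) * y ^ (n + 1)) * x ^ n = 1 - x * y := by
  have h1 := pow_mul_pow_one h n
  have h2 : y ^ n * (x ^ (n + 1) * y ^ (n + 1)) * x ^ n
      = (y ^ n * x ^ n) * (x * y) * (y ^ n * x ^ n) := by
    rw [pow_succ x, pow_succ' y]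
    simp only [mul_assoc]
  rw [mul_sub, sub_mul, mul_one, h1, h2, h1, one_mul, mul_one]

/-- `R` is neither left nor right noetherian: there is a strictly
ascending infinite chain of left ideals of `R`, and a strictly ascending infinite
chain of right ideals (submodules of `R` over `Rᵐᵒᵖ`). -/
theorem not_left_or_right_noetherian (k : Type) [Field k] :
    (∃ c : ℕ → Ideal (R k), StrictMono c) ∧
    (∃ c : ℕ → Submodule (R k)ᵐᵒᵖ (R k), StrictMono c) := by
  have hyx := Yg_mul_Xg k
  have hxy := Xg_mul_Yg_ne k
  generalize Xg k = x at *
  generalize Yg k = y at *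
  have hne : (1 : R k) - x * y ≠ 0 := fun h => hxy (sub_eq_zero.mp h).symm
  constructor
  · refine ⟨fun n =>
      { carrier := {r | r * x ^ n = 0}
        add_mem' := fun {a b} ha hb => by
          simp only [Set.mem_setOf_eq] at *
          rw [add_mul, ha, hb, add_zero]
        zero_mem' := zero_mul _
        smul_mem' := fun c r hr => by
          simp only [Set.mem_setOf_eq, smul_eq_mul] at *
          rw [mul_assoc, hr, mul_zero] }, strictMono_nat_of_lt_succ fun n => ?_⟩
    refine lt_of_le_of_ne ?_ ?_
    · intro r hr
      change r * x ^ (n + 1) = 0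
      have hr' : r * x ^ n = 0 := hr
      rw [pow_succ, ← mul_assoc, hr', zero_mul]
    · intro he
      have hm : (1 - x ^ (n + 1) * y ^ (n + 1)) * x ^ (n + 1) = 0 := by
        rw [sub_mul, mul_assoc, pow_mul_pow_one hyx, one_mul, mul_one, sub_self]
      have hm' : (1 - x ^ (n + 1) * y ^ (n + 1)) * x ^ n = 0 :=
        (SetLike.ext_iff.mp he (1 - x ^ (n + 1) * y ^ (n + 1))).mpr hm
      apply hne
      rw [← key_mul hyx n, mul_assoc, hm', mul_zero]
  · refine ⟨fun n =>
      { carrier := {r | y ^ n * r = 0}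
        add_mem' := fun {a b} ha hb => by
          simp only [Set.mem_setOf_eq] at *
          rw [mul_add, ha, hb, add_zero]
        zero_mem' := mul_zero _
        smul_mem' := fun c r hr => by
          simp only [Set.mem_setOf_eq, MulOpposite.smul_eq_mul_unop] at *
          rw [← mul_assoc, hr, zero_mul] }, strictMono_nat_of_lt_succ fun n => ?_⟩
    refine lt_of_le_of_ne ?_ ?_
    · intro r hr
      change y ^ (n + 1) * r = 0
      have hr' : y ^ n * r = 0 := hr
      rw [pow_succ', mul_assoc, hr', mul_zero]
    · intro he
      have hm : y ^ (n + 1) * (1 - x ^ (n + 1) * y ^ (n + 1)) = 0 := by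
        rw [mul_sub, ← mul_assoc, pow_mul_pow_one hyx, one_mul, mul_one, sub_self]
      have hm' : y ^ n * (1 - x ^ (n + 1) * y ^ (n + 1)) = 0 :=
        (SetLike.ext_iff.mp he (1 - x ^ (n + 1) * y ^ (n + 1))).mpr hm
      apply hne
      rw [← key_mul hyx n, hm', zero_mul]
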